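/- arXiv:2410.11349 — 2 statements merged into one kernel-verified Lean document; each statement's English description precedes it below -/
import Mathlib

section
/- Let Θ ⊆ ℝ^d be a nonempty convex compact set, and let Y : Ω → ℝ^d be continuous with sup_{P ∈ 𝒫} E_P[|Y|^{2+δ}] < ∞ for some δ > 0. Let C denote the set of all continuous functions ξ : Ω → ℝ^d with ξ(ω) ∈ Θ for every ω ∈ Ω. Then inf_{ξ ∈ C} sup_{P ∈ 𝒫} E_P[|Y − ξ|²] = sup_{P ∈ 𝒫} inf_{ξ ∈ C} E_P[|Y − ξ|²]. -/
open MeasureTheory Set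
open scoped NNReal ENNReal RealInnerProductSpace

noncomputable section

/-- Bounded Lipschitz real-valued function on a (pseudo)metric space. -/
def IsBLip {α : Type*} [PseudoMetricSpace α] (ψ : α → ℝ) : Prop :=
  (∃ K : ℝ≥0, LipschitzWith K ψ) ∧ ∃ C : ℝ, ∀ x, |ψ x| ≤ C

variable {Ω : Type*} [MeasurableSpace Ω] [TopologicalSpace Ω]

/-- The sublinear expectation `Ê[f] = sup_{P ∈ Pset} E_P[f]`. -/
def hatE (Pset : Set (ProbabilityMeasure Ω)) (f : Ω → ℝ) : ℝ :=
  ⨆ P : Pset, ∫ ω, f ω ∂((P : ProbabilityMeasure Ω) : Measure Ω)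

/-- Convexity of a set of probability measures. -/
def ConvexPM (Pset : Set (ProbabilityMeasure Ω)) : Prop :=
  ∀ P ∈ Pset, ∀ Q ∈ Pset, ∀ a : ℝ≥0, a ≤ 1 →
    ∃ R ∈ Pset, (R : Measure Ω)
      = (a : ℝ≥0∞) • (P : Measure Ω) + ((1 - a : ℝ≥0) : ℝ≥0∞) • (Q : Measure Ω)

/-- `σ(X_1, …, X_i)` for a finite family of `ℝ^d`-valued maps (0-indexed:
`F X i` is generated by `X 0, …, X (i-1)`; `F X 0` is trivial). -/
def sigmaF {d n : ℕ} (X : Fin n → Ω → EuclideanSpace ℝ (Fin d)) (i : ℕ) :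
    MeasurableSpace Ω :=
  ⨆ j : Fin n, ⨆ _ : (j : ℕ) < i, MeasurableSpace.comap (X j) (borel _)

/-- Independence of `X_1, …, X_n` (0-indexed) under the sublinear expectation
associated with `Pset`. -/
def IndepUnder (Pset : Set (ProbabilityMeasure Ω)) {d n : ℕ}
    (X : Fin n → Ω → EuclideanSpace ℝ (Fin d)) : Prop :=
  ∀ (i : ℕ) (hi : i + 1 < n)
    (ψ : ((Fin (i + 1) → EuclideanSpace ℝ (Fin d)) × EuclideanSpace ℝ (Fin d)) → ℝ),
    IsBLip ψ →
    hatE Pset (fun ω => ψ ((fun j => X ⟨j.1, lt_trans j.2 hi⟩ ω), X ⟨i + 1, hi⟩ ω))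
      = hatE Pset (fun ω =>
          hatE Pset (fun ω' => ψ ((fun j => X ⟨j.1, lt_trans j.2 hi⟩ ω), X ⟨i + 1, hi⟩ ω')))

/-- Uniformly bounded second moments over `Pset`. -/
def HasBddMoment2 (Pset : Set (ProbabilityMeasure Ω)) {d : ℕ}
    (X : Ω → EuclideanSpace ℝ (Fin d)) : Prop :=
  ∃ C : ℝ, ∀ P ∈ Pset, Integrable (fun ω => ‖X ω‖ ^ 2) (P : Measure Ω) ∧
    ∫ ω, ‖X ω‖ ^ 2 ∂(P : Measure Ω) ≤ C

/-- `Θ_X = {θ : ⟨θ, p⟩ ≤ Ê[⟨p, X⟩] for all p}`. -/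
def ThetaSet (Pset : Set (ProbabilityMeasure Ω)) {d : ℕ}
    (X : Ω → EuclideanSpace ℝ (Fin d)) : Set (EuclideanSpace ℝ (Fin d)) :=
  {θ | ∀ p : EuclideanSpace ℝ (Fin d), ⟪θ, p⟫ ≤ hatE Pset (fun ω => ⟪p, X ω⟫)}

open Filter Topology

/-- Minimax for a concave-like family `Φ i`, `i ∈ T` compact, of convex continuous functions. -/
theorem iInf_iSup_eq_iSup_iInf_of_isCompact {ι F : Type*} [TopologicalSpace ι]
    [TopologicalSpace F] [AddCommGroup F] [Module ℝ F] [IsTopologicalAddGroup F]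
    [ContinuousSMul ℝ F] {T : Set ι} {S : Set F} (Φ : ι → F → ℝ)
    (hT : IsCompact T) (hTne : T.Nonempty) (hSne : S.Nonempty)
    (hcont : ∀ ξ, ContinuousOn (fun i => Φ i ξ) T)
    (haff : ∀ i ∈ T, ∀ j ∈ T, ∀ a b : ℝ, 0 ≤ a → 0 ≤ b → a + b = 1 →
      ∃ k ∈ T, ∀ ξ, Φ k ξ = a * Φ i ξ + b * Φ j ξ)
    (hconv : ∀ i ∈ T, ConvexOn ℝ S (Φ i))
    (hcontS : ∀ i ∈ T, ContinuousOn (Φ i) S)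
    {m M : ℝ} (hm : ∀ i ∈ T, ∀ ξ ∈ S, m ≤ Φ i ξ) (hM : ∀ i ∈ T, ∀ ξ ∈ S, Φ i ξ ≤ M) :
    ⨅ ξ : S, ⨆ i : T, Φ i ξ = ⨆ i : T, ⨅ ξ : S, Φ i ξ := by
  have : Nonempty T := hTne.to_subtype
  have : Nonempty S := hSne.to_subtype
  have hbelow (i : T) : BddBelow (range fun ξ : S => Φ i ξ) :=
    ⟨m, by rintro _ ⟨ξ, rfl⟩; exact hm i i.2 ξ ξ.2⟩
  have habove (ξ : S) : BddAbove (range fun i : T => Φ i ξ) :=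
    ⟨M, by rintro _ ⟨i, rfl⟩; exact hM i i.2 ξ ξ.2⟩
  have hbelow' : BddBelow (range fun ξ : S => ⨆ i : T, Φ i ξ) :=
    ⟨m, by
      rintro _ ⟨ξ, rfl⟩
      exact le_ciSup_of_le (habove ξ) ⟨_, hTne.some_mem⟩ (hm _ hTne.some_mem ξ ξ.2)⟩
  have habove' : BddAbove (range fun i : T => ⨅ ξ : S, Φ i ξ) :=
    ⟨M, by
      rintro _ ⟨i, rfl⟩
      exact ciInf_le_of_le (hbelow i) (Classical.arbitrary S) (hM i i.2 _ (Subtype.coe_prop _))⟩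
  have hX : IsCompact (Φ '' T) := hT.image_of_continuousOn (continuousOn_pi.2 hcont)
  have hXconv : Convex ℝ (Φ '' T) := by
    rintro _ ⟨i, hi, rfl⟩ _ ⟨j, hj, rfl⟩ a b ha hb hab
    obtain ⟨k, hk, hkΦ⟩ := haff i hi j hj a b ha hb hab
    exact ⟨k, hk, funext fun ξ => by simp [hkΦ]⟩
  have key := Sion.minimax (X := Φ '' T) (Y := S) (f := fun x ξ => -x ξ)
    (hTne.image _) hX
    (fun ξ _ => ((continuous_apply ξ).neg.continuousOn).lowerSemicontinuousOn)
    (fun ξ _ => ConvexOn.quasiconvexOn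
      ⟨hXconv, fun x _ y _ a b _ _ _ => by simp [add_comm]⟩)
    (hconv hTne.some hTne.some_mem).1
    (by
      rintro _ ⟨i, hi, rfl⟩
      exact (hcontS i hi).neg.upperSemicontinuousOn)
    (by
      rintro _ ⟨i, hi, rfl⟩
      exact (hconv i hi).neg.quasiconcaveOn)
    hXconv
    (fun x => -⨅ ξ : S, x ξ)
    (by
      rintro _ ⟨i, hi, rfl⟩
      have := (isGLB_ciInf (hbelow ⟨i, hi⟩)).neg
      convert this using 1
      ext r
      simp [neg_eq_iff_eq_neg])
    (-⨆ i : T, ⨅ ξ : S, Φ i ξ)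
    (by
      have := (isLUB_ciSup habove').neg
      convert this using 1
      ext r
      simp [neg_eq_iff_eq_neg])
    (fun ξ => -⨆ i : T, Φ i ξ)
    (by
      intro ξ hξ
      have := (isLUB_ciSup (habove ⟨ξ, hξ⟩)).neg
      convert this using 1
      ext r
      simp [neg_eq_iff_eq_neg])
    (-⨅ ξ : S, ⨆ i : T, Φ i ξ)
    (by
      have := (isGLB_ciInf hbelow').neg
      convert this using 1
      ext r
      simp [neg_eq_iff_eq_neg])
  exact (neg_injective key).symm

/-- A nonnegative continuous function with a uniformly bounded moment of order `1 + η` has an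
integral depending continuously on the measure, in the topology of weak convergence. -/
theorem continuousOn_integral_of_moment_le {Ω : Type*} [TopologicalSpace Ω] [MeasurableSpace Ω]
    [OpensMeasurableSpace Ω] {Pset : Set (ProbabilityMeasure Ω)} {h : Ω → ℝ} (hh : Continuous h)
    (hpos : ∀ ω, 0 ≤ h ω) {η C : ℝ} (hη : 0 < η)
    (hint : ∀ P ∈ Pset, Integrable (fun ω => h ω ^ (1 + η)) (P : Measure Ω))
    (hC : ∀ P ∈ Pset, ∫ ω, h ω ^ (1 + η) ∂(P : Measure Ω) ≤ C) :
    ContinuousOn (fun P : ProbabilityMeasure Ω => ∫ ω, h ω ∂(P : Measure Ω)) Pset := by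
  let g (n : ℕ) : BoundedContinuousFunction Ω ℝ :=
    BoundedContinuousFunction.ofNormedAddCommGroup (fun ω => min (h ω) (n + 1))
      (hh.min continuous_const) (n + 1) fun ω => by
        rw [Real.norm_of_nonneg (le_min (hpos ω) (by positivity))]
        exact min_le_right _ _
  have htail (n : ℕ) (ω : Ω) : h ω - g n ω ≤ h ω ^ (1 + η) * ((n : ℝ) + 1) ^ (-η) := by
    change h ω - min (h ω) (n + 1) ≤ _
    have hn : (0 : ℝ) < n + 1 := by positivity
    rcases le_total (h ω) (n + 1) with hle | hle
    · rw [min_eq_left hle, sub_self]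
      have := hpos ω
      positivity
    · have h0 : 0 < h ω := hn.trans_le hle
      have : 1 ≤ h ω ^ η * ((n : ℝ) + 1) ^ (-η) := by
        rw [Real.rpow_neg hn.le, ← div_eq_mul_inv, one_le_div (by positivity)]
        exact Real.rpow_le_rpow hn.le hle hη.le
      rw [Real.rpow_add h0, Real.rpow_one, mul_assoc]
      have h2 : h ω - min (h ω) (n + 1) ≤ h ω := by
        rw [min_eq_right hle]; linarith
      exact h2.trans (le_mul_of_one_le_right h0.le this)
  have hlim : Tendsto (fun n : ℕ => C * ((n : ℝ) + 1) ^ (-η)) atTop (𝓝 0) := by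
    have h1 : Tendsto (fun n : ℕ => (n : ℝ) + 1) atTop atTop :=
      tendsto_atTop_add_const_right _ _ tendsto_natCast_atTop_atTop
    simpa using ((tendsto_rpow_neg_atTop hη).comp h1).const_mul C
  have hunif : TendstoUniformlyOn
      (fun (n : ℕ) (P : ProbabilityMeasure Ω) => ∫ ω, g n ω ∂(P : Measure Ω))
      (fun P => ∫ ω, h ω ∂(P : Measure Ω)) atTop Pset := by
    rw [Metric.tendstoUniformlyOn_iff]
    intro ε hε
    filter_upwards [hlim.eventually_lt_const hε] with n hn P hP
    have hnonneg (ω : Ω) : 0 ≤ h ω - g n ω := sub_nonneg.2 (min_le_left _ _)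
    have hgi : Integrable (g n) (P : Measure Ω) := (g n).integrable _
    have hdi : Integrable (fun ω => h ω - g n ω) (P : Measure Ω) :=
      ((hint P hP).mul_const (((n : ℝ) + 1) ^ (-η))).mono'
        (hh.sub (g n).continuous).aestronglyMeasurable (ae_of_all _ fun ω => by
          rw [Real.norm_of_nonneg (hnonneg ω)]
          exact htail n ω)
    have hhi : Integrable h (P : Measure Ω) :=
      (hdi.add hgi).congr (ae_of_all _ fun ω => sub_add_cancel _ _)
    rw [Real.dist_eq, ← integral_sub hhi hgi,
      abs_of_nonneg (integral_nonneg hnonneg)]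
    calc ∫ ω, (h ω - g n ω) ∂(P : Measure Ω)
        ≤ ∫ ω, h ω ^ (1 + η) * ((n : ℝ) + 1) ^ (-η) ∂(P : Measure Ω) :=
          integral_mono hdi ((hint P hP).mul_const _) (htail n)
      _ = (∫ ω, h ω ^ (1 + η) ∂(P : Measure Ω)) * ((n : ℝ) + 1) ^ (-η) :=
          integral_mul_const _ _
      _ ≤ C * ((n : ℝ) + 1) ^ (-η) := by gcongr; exact hC P hP
      _ < ε := hn
  exact hunif.continuousOn (Frequently.of_forall fun n =>
    (ProbabilityMeasure.continuous_integral_boundedContinuousFunction (g n)).continuousOn)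

theorem norm_sub_rpow_le {E : Type*} [NormedAddCommGroup E] {x y : E} {R p : ℝ} (hy : ‖y‖ ≤ R)
    (hp : 0 ≤ p) : ‖x - y‖ ^ p ≤ 2 ^ p * (‖x‖ ^ p + R ^ p) := by
  have hR : 0 ≤ R := (norm_nonneg y).trans hy
  have hle : ‖x - y‖ ≤ 2 * max ‖x‖ R := by
    linarith [norm_sub_le x y, le_max_left ‖x‖ R, le_max_right ‖x‖ R]
  have hmax : max ‖x‖ R ^ p ≤ ‖x‖ ^ p + R ^ p := by
    have hx := Real.rpow_nonneg (norm_nonneg x) p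
    have hr := Real.rpow_nonneg hR p
    rcases max_choice ‖x‖ R with h | h <;> rw [h] <;> linarith
  calc ‖x - y‖ ^ p ≤ (2 * max ‖x‖ R) ^ p := Real.rpow_le_rpow (norm_nonneg _) hle hp
    _ = 2 ^ p * max ‖x‖ R ^ p := Real.mul_rpow zero_le_two (le_max_of_le_right hR)
    _ ≤ _ := by gcongr

theorem norm_sub_sq_le_two_mul {E : Type*} [NormedAddCommGroup E] {x y : E} {R : ℝ}
    (hy : ‖y‖ ≤ R) : ‖x - y‖ ^ 2 ≤ 2 * ‖x‖ ^ 2 + 2 * R ^ 2 := by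
  have h1 : ‖x - y‖ ≤ ‖x‖ + R := (norm_sub_le x y).trans (by gcongr)
  nlinarith [norm_nonneg (x - y), sq_nonneg (‖x‖ - R)]

theorem sq_le_one_add_rpow {x δ : ℝ} (hx : 0 ≤ x) (hδ : 0 ≤ δ) : x ^ 2 ≤ 1 + x ^ (2 + δ) := by
  rcases le_total x 1 with h | h
  · have := Real.rpow_nonneg hx (2 + δ)
    nlinarith
  · have := Real.rpow_le_rpow_of_exponent_le h (by linarith : (2 : ℝ) ≤ 2 + δ)
    rw [Real.rpow_two] at this
    linarith

theorem convexOn_norm_sub_sq {E : Type*} [NormedAddCommGroup E] [NormedSpace ℝ E] (y : E) :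
    ConvexOn ℝ univ fun x => ‖y - x‖ ^ 2 := by
  have h : ConvexOn ℝ univ fun x : E => ‖y - x‖ := by
    simpa [dist_eq_norm, norm_sub_rev] using convexOn_univ_dist y
  exact h.pow (fun _ _ => norm_nonneg _) 2

/-- Sion-type minimax identity: for a nonempty convex compact `Θ ⊆ ℝ^d`
and a continuous `Y` with uniformly bounded `(2+δ)`-moments,
`inf_{ξ ∈ C} sup_{P ∈ 𝒫} E_P[|Y − ξ|²] = sup_{P ∈ 𝒫} inf_{ξ ∈ C} E_P[|Y − ξ|²]`, where
`C` is the set of continuous functions `ξ : Ω → ℝ^d` with values in `Θ`. -/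
theorem minimax_sq_dist
    {Ω : Type*} [MetricSpace Ω] [CompleteSpace Ω] [TopologicalSpace.SeparableSpace Ω]
    [MeasurableSpace Ω] [BorelSpace Ω]
    {d : ℕ} (Pset : Set (ProbabilityMeasure Ω))
    (hne : Pset.Nonempty) (hconv : ConvexPM Pset) (hcomp : IsCompact Pset)
    (Θ : Set (EuclideanSpace ℝ (Fin d)))
    (hΘne : Θ.Nonempty) (hΘconv : Convex ℝ Θ) (hΘcomp : IsCompact Θ)
    (Y : Ω → EuclideanSpace ℝ (Fin d)) (hY : Continuous Y)
    (hmom : ∃ δ : ℝ, 0 < δ ∧ ∃ C : ℝ, ∀ P ∈ Pset,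
      Integrable (fun ω => ‖Y ω‖ ^ (2 + δ)) ((P : ProbabilityMeasure Ω) : Measure Ω) ∧
      ∫ ω, ‖Y ω‖ ^ (2 + δ) ∂((P : ProbabilityMeasure Ω) : Measure Ω) ≤ C) :
    (⨅ ξ : {ξ : Ω → EuclideanSpace ℝ (Fin d) // Continuous ξ ∧ ∀ ω, ξ ω ∈ Θ},
        ⨆ P : Pset, ∫ ω, ‖Y ω - (ξ : Ω → EuclideanSpace ℝ (Fin d)) ω‖ ^ 2
          ∂((P : ProbabilityMeasure Ω) : Measure Ω))
      = ⨆ P : Pset,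
          ⨅ ξ : {ξ : Ω → EuclideanSpace ℝ (Fin d) // Continuous ξ ∧ ∀ ω, ξ ω ∈ Θ},
            ∫ ω, ‖Y ω - (ξ : Ω → EuclideanSpace ℝ (Fin d)) ω‖ ^ 2
              ∂((P : ProbabilityMeasure Ω) : Measure Ω) := by
  obtain ⟨δ, hδ, C, hC⟩ := hmom
  obtain ⟨R, hR⟩ : ∃ R, ∀ θ ∈ Θ, ‖θ‖ ≤ R := hΘcomp.isBounded.exists_norm_le
  let S : Set (BoundedContinuousFunction Ω (EuclideanSpace ℝ (Fin d))) := {ξ | ∀ ω, ξ ω ∈ Θ}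
  let e : {ξ : Ω → EuclideanSpace ℝ (Fin d) // Continuous ξ ∧ ∀ ω, ξ ω ∈ Θ} ≃ S :=
    { toFun := fun ξ => ⟨BoundedContinuousFunction.ofNormedAddCommGroup ξ.1 ξ.2.1 R
        fun ω => hR _ (ξ.2.2 ω), ξ.2.2⟩
      invFun := fun ξ => ⟨ξ.1, ξ.1.continuous, ξ.2⟩
      left_inv := fun _ => rfl
      right_inv := fun _ => rfl }
  let Φ (P : ProbabilityMeasure Ω)
      (ξ : BoundedContinuousFunction Ω (EuclideanSpace ℝ (Fin d))) : ℝ :=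
    ∫ ω, ‖Y ω - ξ ω‖ ^ 2 ∂(P : Measure Ω)
  have hY2 : ∀ P ∈ Pset, Integrable (fun ω => ‖Y ω‖ ^ 2) (P : Measure Ω) := fun P hP =>
    ((integrable_const 1).add (hC P hP).1).mono' (by fun_prop) (ae_of_all _ fun ω => by
      rw [Real.norm_of_nonneg (by positivity)]
      exact sq_le_one_add_rpow (norm_nonneg _) hδ.le)
  have hY2C : ∀ P ∈ Pset, ∫ ω, ‖Y ω‖ ^ 2 ∂(P : Measure Ω) ≤ 1 + C := fun P hP => by
    calc ∫ ω, ‖Y ω‖ ^ 2 ∂(P : Measure Ω)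
        ≤ ∫ ω, (1 + ‖Y ω‖ ^ (2 + δ)) ∂(P : Measure Ω) :=
          integral_mono (hY2 P hP) ((integrable_const 1).add (hC P hP).1)
            fun ω => sq_le_one_add_rpow (norm_nonneg _) hδ.le
      _ = 1 + ∫ ω, ‖Y ω‖ ^ (2 + δ) ∂(P : Measure Ω) := by
          rw [integral_add (integrable_const 1) (hC P hP).1]; simp
      _ ≤ 1 + C := by linarith [(hC P hP).2]
  have hdom : ∀ P ∈ Pset, Integrable (fun ω => 2 * ‖Y ω‖ ^ 2 + 2 * R ^ 2) (P : Measure Ω) :=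
    fun P hP => ((hY2 P hP).const_mul 2).add (integrable_const _)
  have hbound : ∀ ξ ∈ S, ∀ ω, ‖Y ω - ξ ω‖ ^ 2 ≤ 2 * ‖Y ω‖ ^ 2 + 2 * R ^ 2 :=
    fun ξ hξ ω => norm_sub_sq_le_two_mul (hR _ (hξ ω))
  have hint : ∀ P ∈ Pset, ∀ ξ ∈ S, Integrable (fun ω => ‖Y ω - ξ ω‖ ^ 2) (P : Measure Ω) :=
    fun P hP ξ hξ => (hdom P hP).mono' (by fun_prop) (ae_of_all _ fun ω => by
      rw [Real.norm_of_nonneg (by positivity)]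
      exact hbound ξ hξ ω)
  have hintR : ∀ (ξ : BoundedContinuousFunction Ω (EuclideanSpace ℝ (Fin d))), ∀ P ∈ Pset,
      Integrable (fun ω => ‖Y ω - ξ ω‖ ^ 2) (P : Measure Ω) := fun ξ P hP =>
    (((hY2 P hP).const_mul 2).add (integrable_const (2 * ‖ξ‖ ^ 2))).mono' (by fun_prop)
      (ae_of_all _ fun ω => by
        rw [Real.norm_of_nonneg (by positivity)]
        exact norm_sub_sq_le_two_mul (ξ.norm_coe_le_norm ω))
  have key : ⨅ ξ : S, ⨆ P : Pset, Φ P ξ = ⨆ P : Pset, ⨅ ξ : S, Φ P ξ := by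
    refine iInf_iSup_eq_iSup_iInf_of_isCompact Φ hcomp hne ?_ ?_ ?_ ?_ ?_
      (m := 0) (M := 2 * (1 + C) + 2 * R ^ 2) ?_ ?_
    · obtain ⟨θ, hθ⟩ := hΘne
      exact ⟨BoundedContinuousFunction.const Ω θ, fun _ => hθ⟩
    · intro ξ
      have hpow (ω : Ω) : (‖Y ω - ξ ω‖ ^ 2) ^ (1 + δ / 2) = ‖Y ω - ξ ω‖ ^ (2 + δ) := by
        rw [← Real.rpow_two, ← Real.rpow_mul (norm_nonneg _)]
        ring_nf
      have hle (ω : Ω) := norm_sub_rpow_le (x := Y ω) (ξ.norm_coe_le_norm ω)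
        (by positivity : 0 ≤ 2 + δ)
      have hdomδ : ∀ P ∈ Pset, Integrable
          (fun ω => 2 ^ (2 + δ) * (‖Y ω‖ ^ (2 + δ) + ‖ξ‖ ^ (2 + δ))) (P : Measure Ω) :=
        fun P hP => ((hC P hP).1.add (integrable_const _)).const_mul _
      have hintδ : ∀ P ∈ Pset,
          Integrable (fun ω => ‖Y ω - ξ ω‖ ^ (2 + δ)) (P : Measure Ω) := fun P hP =>
        (hdomδ P hP).mono'
          ((hY.sub ξ.continuous).norm.rpow_const
            fun _ => Or.inr (by positivity)).aestronglyMeasurable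
          (ae_of_all _ fun ω => by
            rw [Real.norm_of_nonneg (by positivity)]
            exact hle ω)
      refine continuousOn_integral_of_moment_le (η := δ / 2)
        (C := 2 ^ (2 + δ) * (C + ‖ξ‖ ^ (2 + δ)))
        ((hY.sub ξ.continuous).norm.pow 2) (fun ω => by positivity) (by positivity) ?_ ?_
      · simpa only [hpow] using hintδ
      · intro P hP
        simp only [hpow]
        refine (integral_mono (hintδ P hP) (hdomδ P hP) hle).trans ?_
        rw [integral_const_mul, integral_add (hC P hP).1 (integrable_const _)]
        simp only [integral_const, probReal_univ, one_smul]
        gcongr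
        exact (hC P hP).2
    · intro P hP Q hQ a b ha hb hab
      lift a to ℝ≥0 using ha
      lift b to ℝ≥0 using hb
      have hab' : a + b = 1 := by exact_mod_cast hab
      obtain ⟨K, hK, hKeq⟩ := hconv P hP Q hQ a (hab' ▸ le_self_add)
      rw [← hab', add_tsub_cancel_left] at hKeq
      refine ⟨K, hK, fun ξ => ?_⟩
      change ∫ ω, ‖Y ω - ξ ω‖ ^ 2 ∂(K : Measure Ω) = _
      rw [hKeq, integral_add_measure ((hintR ξ P hP).smul_measure ENNReal.coe_ne_top)
        ((hintR ξ Q hQ).smul_measure ENNReal.coe_ne_top), integral_smul_measure,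
        integral_smul_measure]
      simp [Φ]
    · intro P hP
      have hS : Convex ℝ S := fun ξ hξ ζ hζ a b ha hb hab ω => hΘconv (hξ ω) (hζ ω) ha hb hab
      refine ⟨hS, fun ξ hξ ζ hζ a b ha hb hab => ?_⟩
      have hi := (hint P hP ξ hξ).const_mul a
      have hj := (hint P hP ζ hζ).const_mul b
      simp only [smul_eq_mul, Φ]
      rw [← integral_const_mul, ← integral_const_mul, ← integral_add hi hj]
      exact integral_mono (hint P hP _ (hS hξ hζ ha hb hab)) (hi.add hj) fun ω =>
        (convexOn_norm_sub_sq (Y ω)).2 (mem_univ _) (mem_univ _) ha hb hab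
    · intro P hP
      refine continuousOn_of_dominated (bound := fun ω => 2 * ‖Y ω‖ ^ 2 + 2 * R ^ 2)
        (fun ξ _ => by fun_prop) (fun ξ hξ => ae_of_all _ fun ω => ?_) (hdom P hP)
        (ae_of_all _ fun ω => ?_)
      · rw [Real.norm_of_nonneg (by positivity)]
        exact hbound ξ hξ ω
      · exact ((continuous_const.sub (continuous_eval_const ω)).norm.pow 2).continuousOn
    · exact fun P _ ξ _ => integral_nonneg fun ω => by positivity
    · intro P hP ξ hξ
      refine (integral_mono (hint P hP ξ hξ) (hdom P hP) (hbound ξ hξ)).trans ?_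
      rw [integral_add ((hY2 P hP).const_mul 2) (integrable_const _), integral_const_mul]
      simp only [integral_const, probReal_univ, one_smul]
      linarith [hY2C P hP]
  calc _ = ⨅ ξ : S, ⨆ P : Pset, Φ P ξ := e.iInf_congr fun _ => rfl
    _ = ⨆ P : Pset, ⨅ ξ : S, Φ P ξ := key
    _ = _ := iSup_congr fun P => (e.iInf_congr fun _ => rfl).symm
end
end

section
/- Let X_1, …, X_n be independent under Ê with sup_{P ∈ 𝒫} E_P[|X_i|²] < ∞ for each i, and assume the X_i are identically distributed in the sense that Ê[φ(X_i)] = Ê[φ(X_1)] for every Lipschitz function φ : ℝ^d → ℝ and every i ≤ n. Then Θ_i = Θ_1 for all i ≤ n, the set Θ := {(1/n)(θ_1 + ⋯ + θ_n) : θ_i ∈ Θ_i} equals Θ_1, and Ê[ρ_{Θ_1}²((1/n)∑_{i=1}^n X_i)] ≤ σ̄_1²/n, where σ̄_1² := inf_{θ ∈ Θ_1} Ê[|X_1 − θ|²]. -/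
open MeasureTheory Set
open scoped NNReal ENNReal RealInnerProductSpace

noncomputable section

variable {Ω : Type*} [MeasurableSpace Ω] [TopologicalSpace Ω]

section HatE

omit [TopologicalSpace Ω]

theorem integral_le_hatE {Pset : Set (ProbabilityMeasure Ω)} {f : Ω → ℝ} {C : ℝ}
    (hC : ∀ P ∈ Pset, ∫ ω, f ω ∂(P : Measure Ω) ≤ C) {P : ProbabilityMeasure Ω} (hP : P ∈ Pset) :
    ∫ ω, f ω ∂(P : Measure Ω) ≤ hatE Pset f :=
  le_ciSup (f := fun P : Pset => ∫ ω, f ω ∂((P : ProbabilityMeasure Ω) : Measure Ω))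
    ⟨C, by rintro _ ⟨Q, rfl⟩; exact hC Q Q.2⟩ ⟨P, hP⟩

theorem hatE_le {Pset : Set (ProbabilityMeasure Ω)} (hne : Pset.Nonempty) {f : Ω → ℝ} {C : ℝ}
    (hC : ∀ P ∈ Pset, ∫ ω, f ω ∂(P : Measure Ω) ≤ C) : hatE Pset f ≤ C := by
  have := hne.to_subtype
  exact ciSup_le fun P => hC P P.2

end HatE

theorem sq_min_nonneg_le {a M : ℝ} (ha : 0 ≤ a) (hM : 0 ≤ M) :
    (min a M) ^ 2 ≤ a ^ 2 ∧ (min a M) ^ 2 ≤ M ^ 2 := by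
  have h : 0 ≤ min a M := le_min ha hM
  exact ⟨pow_le_pow_left₀ h (min_le_left _ _) 2, pow_le_pow_left₀ h (min_le_right _ _) 2⟩

theorem LipschitzWith.sq_min {α : Type*} [PseudoMetricSpace α] {g : α → ℝ} {K : ℝ≥0}
    (hg : LipschitzWith K g) (hg0 : ∀ x, 0 ≤ g x) (M : ℝ≥0) :
    LipschitzWith (2 * M * K) fun x => (min (g x) M) ^ 2 := by
  refine LipschitzWith.of_dist_le_mul fun x y => ?_
  have h : |min (g x) M - min (g y) M| ≤ K * dist x y := by
    refine (abs_min_sub_min_le_max _ _ _ _).trans ?_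
    simpa [Real.dist_eq] using hg.dist_le_mul x y
  have hM : (0 : ℝ) ≤ M := M.2
  have hx : 0 ≤ min (g x) M := le_min (hg0 x) hM
  have hy : 0 ≤ min (g y) M := le_min (hg0 y) hM
  have hs : |min (g x) M + min (g y) M| ≤ 2 * M := by
    rw [abs_of_nonneg (add_nonneg hx hy)]
    linarith [min_le_right (g x) (M : ℝ), min_le_right (g y) (M : ℝ)]
  rw [Real.dist_eq, sq_sub_sq, abs_mul]
  push_cast
  calc _ ≤ 2 * (M : ℝ) * (K * dist x y) := mul_le_mul hs h (abs_nonneg _) (by positivity)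
    _ = _ := by ring

theorem LipschitzWith.isBLip_sq_min {α : Type*} [PseudoMetricSpace α] {g : α → ℝ} {K : ℝ≥0}
    (hg : LipschitzWith K g) (hg0 : ∀ x, 0 ≤ g x) (M : ℝ≥0) :
    IsBLip fun x => (min (g x) M) ^ 2 :=
  ⟨⟨_, hg.sq_min hg0 M⟩, (M : ℝ) ^ 2, fun x => by
    rw [abs_of_nonneg (sq_nonneg _)]; exact (sq_min_nonneg_le (hg0 x) M.2).2⟩

/-- Fatou's lemma for the truncations of a nonnegative function. -/
theorem integrable_sq_of_integral_sq_min_le {Ω : Type*} [MeasurableSpace Ω] {P : Measure Ω}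
    [IsProbabilityMeasure P] {g : Ω → ℝ} (hg : Measurable g) (hg0 : ∀ ω, 0 ≤ g ω) {C : ℝ}
    (hC : ∀ M : ℕ, ∫ ω, (min (g ω) M) ^ 2 ∂P ≤ C) :
    Integrable (fun ω => g ω ^ 2) P ∧ ∫ ω, g ω ^ 2 ∂P ≤ C := by
  have hC0 : 0 ≤ C := (integral_nonneg fun ω => sq_nonneg _).trans (hC 0)
  have hm : ∀ M : ℕ, Measurable fun ω => (min (g ω) M) ^ 2 := fun M => by fun_prop
  have hint : ∀ M : ℕ, Integrable (fun ω => (min (g ω) M) ^ 2) P := fun M =>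
    Integrable.of_bound (hm M).aestronglyMeasurable ((M : ℝ) ^ 2) (.of_forall fun ω => by
      rw [Real.norm_of_nonneg (sq_nonneg _)]
      exact (sq_min_nonneg_le (hg0 ω) M.cast_nonneg).2)
  have hlim : ∀ ω, Filter.liminf (fun M : ℕ => ENNReal.ofReal ((min (g ω) M) ^ 2)) Filter.atTop
      = ENNReal.ofReal (g ω ^ 2) := fun ω => by
    refine (tendsto_const_nhds.congr' ?_).liminf_eq
    filter_upwards [Filter.eventually_ge_atTop ⌈g ω⌉₊] with M hM
    rw [min_eq_left ((Nat.le_ceil _).trans (Nat.cast_le.2 hM))]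
  have key : ∫⁻ ω, ENNReal.ofReal (g ω ^ 2) ∂P ≤ ENNReal.ofReal C := by
    calc _ = ∫⁻ ω, Filter.liminf (fun M : ℕ => ENNReal.ofReal ((min (g ω) M) ^ 2))
          Filter.atTop ∂P := by simp_rw [hlim]
      _ ≤ Filter.liminf (fun M : ℕ => ∫⁻ ω, ENNReal.ofReal ((min (g ω) M) ^ 2) ∂P)
          Filter.atTop := lintegral_liminf_le fun M => (hm M).ennreal_ofReal
      _ ≤ Filter.liminf (fun _ : ℕ => ENNReal.ofReal C) Filter.atTop := by
          refine Filter.liminf_le_liminf (.of_forall fun M => ?_)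
          rw [← ofReal_integral_eq_lintegral_ofReal (hint M) (.of_forall fun ω => sq_nonneg _)]
          exact ENNReal.ofReal_le_ofReal (hC M)
      _ = _ := Filter.liminf_const _
  have hi : Integrable (fun ω => g ω ^ 2) P := by
    refine ⟨(hg.pow_const 2).aestronglyMeasurable, ?_⟩
    rw [hasFiniteIntegral_iff_ofReal (.of_forall fun ω => sq_nonneg _)]
    exact key.trans_lt ENNReal.ofReal_lt_top
  refine ⟨hi, ?_⟩
  rwa [← ENNReal.ofReal_le_ofReal_iff hC0,
    ofReal_integral_eq_lintegral_ofReal hi (.of_forall fun ω => sq_nonneg _)]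

section SecondMoment

omit [TopologicalSpace Ω]

variable {E : Type*} [NormedAddCommGroup E] [InnerProductSpace ℝ E] [CompleteSpace E]
  {P : Measure Ω} [IsProbabilityMeasure P] {Y : Ω → E}

/-- Bias-variance decomposition. -/
theorem MeasureTheory.MemLp.integral_norm_sub_integral_add_sq (hY : MemLp Y 2 P) (b : E) :
    ∫ ω, ‖Y ω - ∫ ω', Y ω' ∂P + b‖ ^ 2 ∂P
      = ∫ ω, ‖Y ω - ∫ ω', Y ω' ∂P‖ ^ 2 ∂P + ‖b‖ ^ 2 := by
  set m := ∫ ω', Y ω' ∂P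
  have h2 : MemLp (fun ω => Y ω - m) 2 P := hY.sub (memLp_const m)
  have h1 : Integrable (fun ω => Y ω - m) P := h2.integrable one_le_two
  have h0 : ∫ ω, ⟪Y ω - m, b⟫ ∂P = 0 := by
    simp_rw [real_inner_comm b]
    rw [integral_inner h1, integral_sub (hY.integrable one_le_two) (integrable_const _)]
    simp [m]
  have hi : Integrable (fun ω => 2 * ⟪Y ω - m, b⟫) P := (h1.inner_const b).const_mul 2
  have hn : Integrable (fun ω => ‖Y ω - m‖ ^ 2) P := h2.integrable_norm_pow two_ne_zero
  simp_rw [norm_add_sq_real]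
  rw [integral_add (by exact hn.add hi) (integrable_const _), integral_add hn hi, integral_const_mul, h0]
  simp

theorem MeasureTheory.MemLp.integral_norm_sub_integral_add_sq_le (hY : MemLp Y 2 P) (b θ : E) :
    ∫ ω, ‖Y ω - ∫ ω', Y ω' ∂P + b‖ ^ 2 ∂P ≤ ‖b‖ ^ 2 + ∫ ω, ‖Y ω - θ‖ ^ 2 ∂P := by
  have h := hY.integral_norm_sub_integral_add_sq (∫ ω', Y ω' ∂P - θ)
  simp only [sub_add_sub_cancel] at h
  rw [h, hY.integral_norm_sub_integral_add_sq]
  linarith [sq_nonneg ‖∫ ω', Y ω' ∂P - θ‖]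

end SecondMoment

section Theta

omit [TopologicalSpace Ω]

variable {d : ℕ} {Pset : Set (ProbabilityMeasure Ω)} {Y : Ω → EuclideanSpace ℝ (Fin d)}

theorem HasBddMoment2.memLp (h : HasBddMoment2 Pset Y) (hY : Measurable Y)
    {P : ProbabilityMeasure Ω} (hP : P ∈ Pset) : MemLp Y 2 (P : Measure Ω) := by
  obtain ⟨C, hC⟩ := h
  exact (memLp_two_iff_integrable_sq_norm hY.aestronglyMeasurable).2 (hC P hP).1

theorem HasBddMoment2.exists_integral_norm_sub_sq_le (h : HasBddMoment2 Pset Y)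
    (θ : EuclideanSpace ℝ (Fin d)) :
    ∃ C : ℝ, ∀ P ∈ Pset, ∫ ω, ‖Y ω - θ‖ ^ 2 ∂(P : Measure Ω) ≤ C := by
  obtain ⟨C, hC⟩ := id h
  refine ⟨2 * C + 2 * ‖θ‖ ^ 2, fun P hP => ?_⟩
  have hi := (hC P hP).1
  calc ∫ ω, ‖Y ω - θ‖ ^ 2 ∂(P : Measure Ω)
      ≤ ∫ ω, (2 * ‖Y ω‖ ^ 2 + 2 * ‖θ‖ ^ 2) ∂(P : Measure Ω) := by
        refine integral_mono_of_nonneg (.of_forall fun ω => sq_nonneg _)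
          ((hi.const_mul 2).add (integrable_const _)) (.of_forall fun ω => ?_)
        have := parallelogram_law_with_norm ℝ (Y ω) θ
        dsimp only
        nlinarith [sq_nonneg ‖Y ω + θ‖]
    _ = 2 * ∫ ω, ‖Y ω‖ ^ 2 ∂(P : Measure Ω) + 2 * ‖θ‖ ^ 2 := by
        rw [integral_add (hi.const_mul 2) (integrable_const _), integral_const_mul]
        simp
    _ ≤ _ := by linarith [(hC P hP).2]

theorem HasBddMoment2.integral_mem_thetaSet (h : HasBddMoment2 Pset Y) (hY : Measurable Y)
    {P : ProbabilityMeasure Ω} (hP : P ∈ Pset) :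
    ∫ ω, Y ω ∂(P : Measure Ω) ∈ ThetaSet Pset Y := by
  intro p
  have hint : ∀ Q ∈ Pset, Integrable Y (Q : Measure Ω) := fun Q hQ =>
    (h.memLp hY hQ).integrable one_le_two
  rw [real_inner_comm, ← integral_inner (hint P hP)]
  obtain ⟨C, hC⟩ := h
  refine integral_le_hatE (C := ‖p‖ ^ 2 + C) (fun Q hQ => ?_) hP
  calc ∫ ω, ⟪p, Y ω⟫ ∂(Q : Measure Ω) ≤ ∫ ω, (‖p‖ ^ 2 + ‖Y ω‖ ^ 2) ∂(Q : Measure Ω) := by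
        refine integral_mono ((hint Q hQ).const_inner p)
          ((integrable_const _).add (hC Q hQ).1) fun ω => ?_
        refine (real_inner_le_norm _ _).trans ?_
        nlinarith [sq_nonneg (‖p‖ - ‖Y ω‖), sq_nonneg ‖p‖, sq_nonneg ‖Y ω‖]
    _ = ‖p‖ ^ 2 + ∫ ω, ‖Y ω‖ ^ 2 ∂(Q : Measure Ω) := by
        rw [integral_add (integrable_const _) (hC Q hQ).1]
        simp
    _ ≤ _ := by linarith [(hC Q hQ).2]

/-- The dilation `c Θ_Y`, described through its support function. -/
def thetaDilation (Pset : Set (ProbabilityMeasure Ω)) (Y : Ω → EuclideanSpace ℝ (Fin d)) (c : ℝ) :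
    Set (EuclideanSpace ℝ (Fin d)) :=
  {x | ∀ p : EuclideanSpace ℝ (Fin d), ⟪x, p⟫ ≤ c * hatE Pset (fun ω => ⟪p, Y ω⟫)}

theorem isClosed_thetaDilation (c : ℝ) : IsClosed (thetaDilation Pset Y c) := by
  simp only [thetaDilation, ofPred_forall]
  exact isClosed_iInter fun p => isClosed_le (by fun_prop) continuous_const

theorem smul_mem_thetaDilation {θ : EuclideanSpace ℝ (Fin d)} (hθ : θ ∈ ThetaSet Pset Y) {c : ℝ}
    (hc : 0 ≤ c) : c • θ ∈ thetaDilation Pset Y c := fun p => by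
  rw [real_inner_smul_left]
  exact mul_le_mul_of_nonneg_left (hθ p) hc

theorem inv_smul_mem_thetaSet {x : EuclideanSpace ℝ (Fin d)} {c : ℝ} (hc : 0 < c)
    (hx : x ∈ thetaDilation Pset Y c) : c⁻¹ • x ∈ ThetaSet Pset Y := fun p => by
  rw [real_inner_smul_left, inv_mul_le_iff₀ hc]
  exact hx p

theorem add_mem_thetaDilation {x θ : EuclideanSpace ℝ (Fin d)} {c : ℝ}
    (hx : x ∈ thetaDilation Pset Y c) (hθ : θ ∈ ThetaSet Pset Y) :
    x + θ ∈ thetaDilation Pset Y (c + 1) := fun p => by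
  rw [inner_add_left]
  linarith [hx p, hθ p]

/-- The step of the induction on the number of summands, for a frozen partial sum `x`. -/
theorem integral_sq_infDist_add_le {Z : Ω → EuclideanSpace ℝ (Fin d)} {P : Measure Ω}
    [IsProbabilityMeasure P] (hZ : MemLp Z 2 P) (hmean : ∫ ω, Z ω ∂P ∈ ThetaSet Pset Y)
    {c : ℝ} (hc : 0 ≤ c) (x θ : EuclideanSpace ℝ (Fin d)) {f : Ω → ℝ} (hf : ∀ ω, 0 ≤ f ω)
    (hle : ∀ ω, f ω ≤ Metric.infDist (x + Z ω) (thetaDilation Pset Y (c + 1)) ^ 2) :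
    ∫ ω, f ω ∂P
      ≤ Metric.infDist x (thetaDilation Pset Y c) ^ 2 + ∫ ω, ‖Z ω - θ‖ ^ 2 ∂P := by
  obtain ⟨y, hy, hxy⟩ := (isClosed_thetaDilation (Pset := Pset) (Y := Y) c).exists_infDist_eq_dist
    ⟨_, smul_mem_thetaDilation hmean hc⟩ x
  rw [hxy, dist_eq_norm]
  refine le_trans ?_ (hZ.integral_norm_sub_integral_add_sq_le (x - y) θ)
  have hi : MemLp (fun ω => Z ω - ∫ ω', Z ω' ∂P + (x - y)) 2 P :=
    (hZ.sub (memLp_const _)).add (memLp_const _)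
  refine integral_mono_of_nonneg (.of_forall hf) (hi.integrable_norm_pow two_ne_zero)
    (.of_forall fun ω => (hle ω).trans ?_)
  refine pow_le_pow_left₀ Metric.infDist_nonneg ?_ 2
  refine (Metric.infDist_le_dist_of_mem (add_mem_thetaDilation hy hmean)).trans_eq ?_
  rw [dist_eq_norm]
  congr 1
  abel

theorem infDist_inv_smul_thetaSet_le (hne : (ThetaSet Pset Y).Nonempty) {c : ℝ} (hc : 0 < c)
    (x : EuclideanSpace ℝ (Fin d)) :
    Metric.infDist (c⁻¹ • x) (ThetaSet Pset Y)
      ≤ c⁻¹ * Metric.infDist x (thetaDilation Pset Y c) := by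
  obtain ⟨θ, hθ⟩ := hne
  obtain ⟨y, hy, hxy⟩ := (isClosed_thetaDilation (Pset := Pset) (Y := Y) c).exists_infDist_eq_dist
    ⟨_, smul_mem_thetaDilation hθ hc.le⟩ x
  refine (Metric.infDist_le_dist_of_mem (inv_smul_mem_thetaSet hc hy)).trans_eq ?_
  rw [dist_smul₀, Real.norm_of_nonneg (inv_nonneg.2 hc.le), hxy]

theorem convex_thetaSet : Convex ℝ (ThetaSet Pset Y) := by
  intro x hx y hy a b ha hb hab p
  rw [inner_add_left, real_inner_smul_left, real_inner_smul_left]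
  calc _ ≤ a * hatE Pset (fun ω => ⟪p, Y ω⟫) + b * hatE Pset (fun ω => ⟪p, Y ω⟫) :=
        add_le_add (mul_le_mul_of_nonneg_left (hx p) ha) (mul_le_mul_of_nonneg_left (hy p) hb)
    _ = _ := by rw [← add_mul, hab, one_mul]

theorem Convex.setOf_inv_smul_sum_eq {E : Type*} [AddCommGroup E] [Module ℝ E] {s : Set E}
    (hs : Convex ℝ s) {n : ℕ} (hn : 0 < n) :
    {x | ∃ θ : Fin n → E, (∀ i, θ i ∈ s) ∧ x = (n : ℝ)⁻¹ • ∑ i, θ i} = s := by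
  have hn' : (n : ℝ) ≠ 0 := by positivity
  ext x
  constructor
  · rintro ⟨θ, hθ, rfl⟩
    rw [Finset.smul_sum]
    exact hs.sum_mem (fun i _ => by positivity) (by simp [hn']) fun i _ => hθ i
  · intro hx
    refine ⟨fun _ => x, fun _ => hx, ?_⟩
    simp [← Nat.cast_smul_eq_nsmul ℝ, smul_smul, hn']

end Theta

theorem exists_lipschitzWith_sum_add (k d : ℕ) : ∃ K : ℝ≥0, LipschitzWith K
    fun z : (Fin k → EuclideanSpace ℝ (Fin d)) × EuclideanSpace ℝ (Fin d) =>
      ∑ j, z.1 j + z.2 := by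
  let L : ((Fin k → EuclideanSpace ℝ (Fin d)) × EuclideanSpace ℝ (Fin d)) →L[ℝ]
      EuclideanSpace ℝ (Fin d) :=
    (∑ j, ContinuousLinearMap.proj j) ∘L ContinuousLinearMap.fst ℝ _ _ +
      ContinuousLinearMap.snd ℝ _ _
  refine ⟨‖L‖₊, ?_⟩
  have hL : ⇑L = fun z => ∑ j, z.1 j + z.2 := by
    ext1 z
    simp [L]
  exact hL ▸ L.lipschitz

section IID

omit [TopologicalSpace Ω]

variable {d n : ℕ} {Pset : Set (ProbabilityMeasure Ω)} {X : Fin n → Ω → EuclideanSpace ℝ (Fin d)}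

/-- A transfer of second moments along equality in distribution tested on Lipschitz functions. -/
theorem integral_norm_sub_sq_le_hatE {Y Z : Ω → EuclideanSpace ℝ (Fin d)} (hne : Pset.Nonempty)
    (hY : Measurable Y) (hZ : Measurable Z) (hmom : HasBddMoment2 Pset Y)
    (hYZ : ∀ φ : EuclideanSpace ℝ (Fin d) → ℝ, (∃ K : ℝ≥0, LipschitzWith K φ) →
      hatE Pset (fun ω => φ (Z ω)) = hatE Pset (fun ω => φ (Y ω)))
    (θ : EuclideanSpace ℝ (Fin d)) {P : ProbabilityMeasure Ω} (hP : P ∈ Pset) :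
    ∫ ω, ‖Z ω - θ‖ ^ 2 ∂(P : Measure Ω) ≤ hatE Pset (fun ω => ‖Y ω - θ‖ ^ 2) := by
  obtain ⟨C, hC⟩ := hmom.exists_integral_norm_sub_sq_le θ
  refine (integrable_sq_of_integral_sq_min_le (hZ.sub_const θ).norm
    (fun ω => norm_nonneg _) fun M => ?_).2
  have hlip : LipschitzWith 1 fun y : EuclideanSpace ℝ (Fin d) => ‖y - θ‖ := by
    simpa only [dist_eq_norm] using LipschitzWith.dist_left θ
  have h := hYZ _ ⟨_, hlip.sq_min (fun y => norm_nonneg _) M⟩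
  simp only [NNReal.coe_natCast] at h
  calc ∫ ω, (min ‖Z ω - θ‖ M) ^ 2 ∂(P : Measure Ω)
      ≤ hatE Pset fun ω => (min ‖Z ω - θ‖ M) ^ 2 := by
        refine integral_le_hatE (C := (M : ℝ) ^ 2) (fun Q _ => ?_) hP
        refine (integral_mono_of_nonneg (.of_forall fun ω => sq_nonneg _)
          (integrable_const ((M : ℝ) ^ 2)) (.of_forall fun ω =>
            (sq_min_nonneg_le (norm_nonneg _) M.cast_nonneg).2)).trans_eq (by simp)
    _ = hatE Pset fun ω => (min ‖Y ω - θ‖ M) ^ 2 := h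
    _ ≤ _ := hatE_le hne fun Q hQ => by
        refine le_trans ?_ (integral_le_hatE hC hQ)
        exact integral_mono_of_nonneg (.of_forall fun ω => sq_nonneg _)
          (((hmom.memLp hY hQ).sub (memLp_const θ)).integrable_norm_pow two_ne_zero)
          (.of_forall fun ω => (sq_min_nonneg_le (norm_nonneg _) M.cast_nonneg).1)

theorem integral_sq_infDist_partial_sum_le (hne : Pset.Nonempty) (hmeas : ∀ i, Measurable (X i))
    (hmom : ∀ i, HasBddMoment2 Pset (X i)) (hindep : IndepUnder Pset X)
    {Y : Ω → EuclideanSpace ℝ (Fin d)} (hΘ : ∀ i, ThetaSet Pset (X i) = ThetaSet Pset Y)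
    (θ : EuclideanSpace ℝ (Fin d)) {v : ℝ}
    (hv : ∀ i, ∀ P ∈ Pset, ∫ ω, ‖X i ω - θ‖ ^ 2 ∂(P : Measure Ω) ≤ v) (k : ℕ) (hk : k + 1 ≤ n)
    {P : ProbabilityMeasure Ω} (hP : P ∈ Pset) :
    Integrable (fun ω => Metric.infDist (∑ j : Fin (k + 1), X ⟨j.1, j.2.trans_le hk⟩ ω)
        (thetaDilation Pset Y ((k + 1 : ℕ) : ℝ)) ^ 2) (P : Measure Ω) ∧
      ∫ ω, Metric.infDist (∑ j : Fin (k + 1), X ⟨j.1, j.2.trans_le hk⟩ ω)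
        (thetaDilation Pset Y ((k + 1 : ℕ) : ℝ)) ^ 2 ∂(P : Measure Ω) ≤ (k + 1 : ℕ) * v := by
  have hmean : ∀ i, ∀ Q ∈ Pset, ∫ ω, X i ω ∂(Q : Measure Ω) ∈ ThetaSet Pset Y := fun i Q hQ =>
    hΘ i ▸ (hmom i).integral_mem_thetaSet (hmeas i) hQ
  induction k generalizing P with
  | zero =>
    refine integrable_sq_of_integral_sq_min_le ?_ (fun _ => Metric.infDist_nonneg) fun M => ?_
    · exact (Finset.measurable_fun_sum _ fun j _ => hmeas _).infDist
    have h0 : (0 : EuclideanSpace ℝ (Fin d)) ∈ thetaDilation Pset Y 0 := fun p => by simp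
    have h := integral_sq_infDist_add_le (Pset := Pset) (Y := Y)
      ((hmom ⟨0, hk⟩).memLp (hmeas _) hP) (hmean ⟨0, hk⟩ P hP) le_rfl 0 θ
      (f := fun ω => (min (Metric.infDist (X ⟨0, hk⟩ ω) (thetaDilation Pset Y 1)) M) ^ 2)
      (fun _ => sq_nonneg _) fun ω => by
        simpa using (sq_min_nonneg_le Metric.infDist_nonneg M.cast_nonneg).1
    rw [Metric.infDist_zero_of_mem h0] at h
    simpa using h.trans (by simpa using hv _ P hP)
  | succ k ih =>
    refine integrable_sq_of_integral_sq_min_le ?_ (fun _ => Metric.infDist_nonneg) fun M => ?_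
    · exact (Finset.measurable_fun_sum _ fun j _ => hmeas _).infDist
    obtain ⟨K, hK⟩ := exists_lipschitzWith_sum_add (k + 1) d
    have hlip := (Metric.lipschitz_infDist_pt (thetaDilation Pset Y ((k + 1 + 1 : ℕ) : ℝ))).comp hK
    have hind := hindep k hk _ (hlip.isBLip_sq_min (fun _ => Metric.infDist_nonneg) M)
    simp only [NNReal.coe_natCast, Function.comp_apply] at hind
    simp_rw [Fin.sum_univ_castSucc (n := k + 1)]
    calc _ ≤ _ := by
          refine integral_le_hatE (C := (M : ℝ) ^ 2) (fun Q _ => ?_) hP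
          refine (integral_mono_of_nonneg (.of_forall fun ω => sq_nonneg _)
            (integrable_const ((M : ℝ) ^ 2)) (.of_forall fun ω =>
              (sq_min_nonneg_le Metric.infDist_nonneg M.cast_nonneg).2)).trans_eq (by simp)
      _ = _ := hind
      _ ≤ _ := hatE_le hne fun Q hQ => by
          obtain ⟨hi, hle⟩ := ih (Nat.le_of_succ_le hk) hQ
          calc _ ≤ ∫ ω, (Metric.infDist (∑ j : Fin (k + 1), X ⟨j.1, _⟩ ω)
                (thetaDilation Pset Y ((k + 1 : ℕ) : ℝ)) ^ 2 + v) ∂(Q : Measure Ω) := by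
                refine integral_mono_of_nonneg (.of_forall fun ω => ?_)
                  (hi.add (integrable_const v)) (.of_forall fun ω => ?_)
                · exact Real.iSup_nonneg fun R => integral_nonneg fun ω' => sq_nonneg _
                · refine hatE_le hne fun R hR => ?_
                  refine (integral_sq_infDist_add_le ((hmom _).memLp (hmeas _) hR)
                    (hmean ⟨k + 1, hk⟩ R hR) (Nat.cast_nonneg (k + 1)) _ θ
                    (fun _ => sq_nonneg _) fun ω' => ?_).trans
                    (add_le_add_right (hv ⟨k + 1, hk⟩ R hR) _)
                  rw [← Nat.cast_succ]
                  exact (sq_min_nonneg_le Metric.infDist_nonneg M.cast_nonneg).1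
            _ = _ := integral_add hi (integrable_const v)
            _ ≤ _ := by
                push_cast at hle ⊢
                simp only [integral_const, probReal_univ, one_smul]
                linarith

end IID

/-- for independent, identically distributed `X_1, …, X_n` (0-indexed here)
with uniformly bounded second moments: all `Θ_i` coincide with `Θ_1`, the Minkowski
average `Θ` equals `Θ_1`, and `Ê[ρ_{Θ_1}²((1/n) ∑ X_i)] ≤ σ̄_1²/n`. -/
theorem iid_hatE_sq_infDist_sample_mean_le
    {Ω : Type*} [MetricSpace Ω] [CompleteSpace Ω] [TopologicalSpace.SeparableSpace Ω]
    [MeasurableSpace Ω] [BorelSpace Ω]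
    {d n : ℕ} (hn : 0 < n) (Pset : Set (ProbabilityMeasure Ω))
    (hne : Pset.Nonempty) (hconv : ConvexPM Pset) (hcomp : IsCompact Pset)
    (X : Fin n → Ω → EuclideanSpace ℝ (Fin d))
    (hmeas : ∀ i, Measurable (X i))
    (hmom : ∀ i, HasBddMoment2 Pset (X i))
    (hindep : IndepUnder Pset X)
    (hiid : ∀ (i : Fin n) (φ : EuclideanSpace ℝ (Fin d) → ℝ),
      (∃ K : ℝ≥0, LipschitzWith K φ) →
      hatE Pset (fun ω => φ (X i ω)) = hatE Pset (fun ω => φ (X ⟨0, hn⟩ ω))) :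
    (∀ i : Fin n, ThetaSet Pset (X i) = ThetaSet Pset (X ⟨0, hn⟩)) ∧
    {x | ∃ θ : Fin n → EuclideanSpace ℝ (Fin d),
        (∀ i, θ i ∈ ThetaSet Pset (X i)) ∧ x = (n : ℝ)⁻¹ • ∑ i, θ i}
      = ThetaSet Pset (X ⟨0, hn⟩) ∧
    hatE Pset (fun ω =>
        (Metric.infDist ((n : ℝ)⁻¹ • ∑ i, X i ω) (ThetaSet Pset (X ⟨0, hn⟩))) ^ 2)
      ≤ (sInf {v : ℝ | ∃ θ ∈ ThetaSet Pset (X ⟨0, hn⟩),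
          v = hatE Pset (fun ω => ‖X ⟨0, hn⟩ ω - θ‖ ^ 2)}) / n := by
  have hΘ : ∀ i : Fin n, ThetaSet Pset (X i) = ThetaSet Pset (X ⟨0, hn⟩) := fun i => by
    have h : ∀ p : EuclideanSpace ℝ (Fin d), hatE Pset (fun ω => ⟪p, X i ω⟫)
        = hatE Pset (fun ω => ⟪p, X ⟨0, hn⟩ ω⟫) := fun p =>
      hiid i (fun x => ⟪p, x⟫) ⟨_, (innerSL ℝ p).lipschitz⟩
    simp only [ThetaSet, h]
  have hn' : (0 : ℝ) < n := Nat.cast_pos.2 hn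
  have hΘne : (ThetaSet Pset (X ⟨0, hn⟩)).Nonempty := by
    obtain ⟨P, hP⟩ := hne
    exact ⟨_, (hmom _).integral_mem_thetaSet (hmeas _) hP⟩
  refine ⟨hΘ, ?_, ?_⟩
  · simp only [hΘ]
    exact convex_thetaSet.setOf_inv_smul_sum_eq hn
  rw [le_div_iff₀ hn']
  refine le_csInf (hΘne.elim fun θ hθ => ⟨_, θ, hθ, rfl⟩) ?_
  rintro _ ⟨θ, -, rfl⟩
  rw [← le_div_iff₀ hn']
  refine hatE_le hne fun P hP => ?_
  obtain ⟨k, rfl⟩ := Nat.exists_eq_succ_of_ne_zero hn.ne'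
  obtain ⟨hi, hle⟩ := integral_sq_infDist_partial_sum_le hne hmeas hmom hindep hΘ θ
    (fun i P hP => integral_norm_sub_sq_le_hatE hne (hmeas _) (hmeas i) (hmom _) (hiid i) θ hP)
    k le_rfl hP
  set c : ℝ := ((k + 1 : ℕ) : ℝ)
  calc _ ≤ ∫ ω, (c⁻¹ ^ 2 * Metric.infDist (∑ j, X j ω)
        (thetaDilation Pset (X ⟨0, hn⟩) c) ^ 2) ∂(P : Measure Ω) := by
        refine integral_mono_of_nonneg (.of_forall fun ω => sq_nonneg _) (hi.const_mul _)
          (.of_forall fun ω => ?_)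
        dsimp only
        rw [← mul_pow]
        exact pow_le_pow_left₀ Metric.infDist_nonneg (infDist_inv_smul_thetaSet_le hΘne hn' _) 2
    _ ≤ c⁻¹ ^ 2 * (c * hatE Pset fun ω => ‖X ⟨0, hn⟩ ω - θ‖ ^ 2) := by
        rw [integral_const_mul]
        exact mul_le_mul_of_nonneg_left hle (by positivity)
    _ = _ := by
        have : c ≠ 0 := hn'.ne'
        field_simp
end
end
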